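/- Let P be a simple polygon with vertex set V in ℝ², and suppose u, z, w are three distinct extreme points of conv(V) such that z lies strictly between u and w in the circular hull order (on one of the two hull arcs from u to w, with no hypothesis on the other arc). If along the boundary of P the vertex z does not occur between u and w on either boundary arc that would be consistent with the hull order, then P is not simple. Equivalently (contrapositive form of the order lemma): in a simple polygon, for any three extreme points u, z, w of the convex hull of its vertices, the cyclic orientation of (u, z, w) along the polygon boundary agrees with their cyclic orientation along the convex hull boundary. -/

import Mathlib

open Set

/-- Points in the plane. -/
abbrev Pt := ℝ × ℝ

/-- Orientation (twice signed area) of a triple of points. -/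
noncomputable def orient (a b c : Pt) : ℝ :=
  (b.1 - a.1) * (c.2 - a.2) - (b.2 - a.2) * (c.1 - a.1)

/-- A simple polygon: a cyclic sequence of at least three distinct vertices whose
consecutive-vertex edges meet only as forced (adjacent edges share exactly their
common vertex, non-adjacent edges are disjoint). -/
structure SimplePolygon where
  n : ℕ
  three_le : 3 ≤ n
  verts : ZMod n → Pt
  inj : Function.Injective verts
  edges_nonadj : ∀ i j : ZMod n, j ≠ i → j ≠ i + 1 → i ≠ j + 1 →
    segment ℝ (verts i) (verts (i + 1)) ∩ segment ℝ (verts j) (verts (j + 1)) = ∅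
  edges_adj : ∀ i : ZMod n,
    segment ℝ (verts i) (verts (i + 1)) ∩ segment ℝ (verts (i + 1)) (verts (i + 1 + 1))
      = {verts (i + 1)}

/-- The boundary curve of a simple polygon. -/
def SimplePolygon.boundary (P : SimplePolygon) : Set Pt :=
  ⋃ i : ZMod P.n, segment ℝ (P.verts i) (P.verts (i + 1))

/-- The interior region of a simple polygon: points off the boundary whose connected
component in the complement of the boundary is bounded. -/
def SimplePolygon.interiorRegion (P : SimplePolygon) : Set Pt :=
  {x | x ∉ P.boundary ∧ Bornology.IsBounded (connectedComponentIn P.boundaryᶜ x)}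

/-- The exterior region of a simple polygon: points off the boundary whose connected
component in the complement of the boundary is unbounded. -/
def SimplePolygon.exteriorRegion (P : SimplePolygon) : Set Pt :=
  {x | x ∉ P.boundary ∧ ¬ Bornology.IsBounded (connectedComponentIn P.boundaryᶜ x)}

/-- `v` is a vertex of the polygon `P`. -/
def SimplePolygon.IsVertex (P : SimplePolygon) (v : Pt) : Prop := v ∈ Set.range P.verts

/-- The (unordered) pair `u v` forms an edge of `P`. -/
def SimplePolygon.IsEdgeOf (P : SimplePolygon) (u v : Pt) : Prop :=
  ∃ i : ZMod P.n, (u = P.verts i ∧ v = P.verts (i + 1)) ∨ (v = P.verts i ∧ u = P.verts (i + 1))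

/-- The segment `uv` is an internal diagonal of `P`: a segment joining two
non-adjacent vertices whose relative interior lies in the interior of `P`. -/
def SimplePolygon.IsInternalDiagonal (P : SimplePolygon) (u v : Pt) : Prop :=
  P.IsVertex u ∧ P.IsVertex v ∧ u ≠ v ∧ ¬ P.IsEdgeOf u v ∧
    openSegment ℝ u v ⊆ P.interiorRegion

/-- The set `V(S)` of endpoints of a family of segments, each given by its pair of
endpoints. -/
def endpointSet (S : Finset (Pt × Pt)) : Set Pt :=
  {p | ∃ s ∈ S, p = s.1 ∨ p = s.2}

/-- `P` is a circumscribing polygon of `S`: the vertex set of `P` is `V(S)` and every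
segment of `S` is an edge or an internal diagonal of `P`. -/
def Circumscribes (P : SimplePolygon) (S : Finset (Pt × Pt)) : Prop :=
  Set.range P.verts = endpointSet S ∧
  ∀ s ∈ S, P.IsEdgeOf s.1 s.2 ∨ P.IsInternalDiagonal s.1 s.2

/-- The segments of `S` are nondegenerate and pairwise disjoint. -/
def PairwiseDisjointSegs (S : Finset (Pt × Pt)) : Prop :=
  (∀ s ∈ S, s.1 ≠ s.2) ∧
  ∀ s ∈ S, ∀ t ∈ S, s ≠ t →
    Disjoint (segment ℝ s.1 s.2) (segment ℝ t.1 t.2)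

/-- All `2|S|` endpoints of the segments of `S` are distinct. -/
def DistinctEndpoints (S : Finset (Pt × Pt)) : Prop :=
  ∀ s ∈ S, ∀ t ∈ S, s.1 ≠ t.2 ∧ (s ≠ t → s.1 ≠ t.1 ∧ s.2 ≠ t.2)

open ComplexConjugate in
/-- The signed angle from `z` to `w`, as the principal argument of `w / z`. -/
noncomputable def signedAngle (z w : ℂ) : ℝ := (w * conj z).arg

/-- The open half-plane `{z | 0 < Re (z * conj u)}`. -/
def openHalfPlane (u : ℂ) : Set ℂ := {z | 0 < z.re * u.re + z.im * u.im}

open ComplexConjugate in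
theorem signedAngle_eq_sub {u z w : ℂ} (hz : z ∈ openHalfPlane u) (hw : w ∈ openHalfPlane u) :
    signedAngle z w = (w * conj u).arg - (z * conj u).arg := by
  have re_pos : ∀ x ∈ openHalfPlane u, 0 < (x * conj u).re := fun x hx => by
    simpa [openHalfPlane] using hx
  have arg_lt : ∀ x ∈ openHalfPlane u, |(x * conj u).arg| < Real.pi / 2 := fun x hx =>
    Complex.abs_arg_lt_pi_div_two_iff.2 (Or.inl (re_pos x hx))
  have ne : ∀ x ∈ openHalfPlane u, x * conj u ≠ 0 := fun x hx h => by
    simpa [h] using re_pos x hx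
  have hz' := abs_lt.1 (arg_lt z hz)
  have hw' := abs_lt.1 (arg_lt w hw)
  have hu : u ≠ 0 := by
    rintro rfl
    simpa using ne z hz
  have harg : (conj (z * conj u)).arg = -(z * conj u).arg := by
    rw [Complex.arg_conj, if_neg]
    linarith [Real.pi_pos]
  have hprod : (w * conj u) * conj (z * conj u) = ((Complex.normSq u : ℝ) : ℂ) * (w * conj z) := by
    rw [Complex.normSq_eq_conj_mul_self]
    simp only [map_mul, Complex.conj_conj]
    ring
  rw [signedAngle, ← Complex.arg_real_mul _ (Complex.normSq_pos.2 hu), ← hprod,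
    (Complex.arg_mul_eq_add_arg_iff (ne w hw) ?_).2, harg, sub_eq_add_neg]
  · rw [harg]
    constructor <;> linarith
  · simpa using ne z hz

theorem signedAngle_add {u x y z : ℂ} (hx : x ∈ openHalfPlane u) (hy : y ∈ openHalfPlane u)
    (hz : z ∈ openHalfPlane u) : signedAngle x y + signedAngle y z = signedAngle x z := by
  rw [signedAngle_eq_sub hx hy, signedAngle_eq_sub hy hz, signedAngle_eq_sub hx hz]
  ring

theorem sum_signedAngle {u : ℂ} {g : ℕ → ℂ} {N : ℕ} (hg : ∀ t ≤ N, g t ∈ openHalfPlane u) :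
    ∑ t ∈ Finset.range N, signedAngle (g t) (g (t + 1)) = signedAngle (g 0) (g N) := by
  have h0 := hg 0 N.zero_le
  rw [signedAngle_eq_sub h0 (hg N le_rfl), ← Finset.sum_range_sub (fun t => (g t * starRingEnd ℂ u).arg) N]
  refine Finset.sum_congr rfl fun t ht => ?_
  rw [Finset.mem_range] at ht
  exact signedAngle_eq_sub (hg t ht.le) (hg (t + 1) ht)

/-- If the increments `h`, `v` along the edges of a grid have zero circulation around each cell,
they have zero circulation around the whole grid. -/
theorem grid_circulation {h v : ℕ → ℕ → ℝ} {S T : ℕ}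
    (cell : ∀ s < S, ∀ t < T, h s t + v s (t + 1) = v s t + h (s + 1) t) :
    ∑ t ∈ Finset.range T, h 0 t + ∑ s ∈ Finset.range S, v s T =
      ∑ s ∈ Finset.range S, v s 0 + ∑ t ∈ Finset.range T, h S t := by
  have key : ∑ s ∈ Finset.range S, ∑ t ∈ Finset.range T, (h (s + 1) t - h s t) =
      ∑ s ∈ Finset.range S, ∑ t ∈ Finset.range T, (v s (t + 1) - v s t) :=
    Finset.sum_congr rfl fun s hs => Finset.sum_congr rfl fun t ht => by
      linarith [cell s (Finset.mem_range.1 hs) t (Finset.mem_range.1 ht)]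
  rw [Finset.sum_comm] at key
  simp only [fun t => Finset.sum_range_sub (fun s => h s t) S,
    fun s => Finset.sum_range_sub (v s) T, Finset.sum_sub_distrib] at key
  linarith

theorem signedAngle_pos {z w : ℂ} (h : 0 < z.re * w.im - z.im * w.re) : 0 < signedAngle z w := by
  have him : 0 < (w * starRingEnd ℂ z).im := by simp; linarith
  refine lt_of_le_of_ne (Complex.arg_nonneg_iff.2 him.le) fun h0 => ?_
  rw [signedAngle, eq_comm, Complex.arg_eq_zero_iff] at h0
  exact him.ne' h0.2

theorem signedAngle_neg {z w : ℂ} (h : z.re * w.im - z.im * w.re < 0) : signedAngle z w < 0 :=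
  Complex.arg_neg_iff.2 (by simp; linarith)

/-- The displacement from `b` to `a` as a complex number. -/
def displacement (a b : Pt) : ℂ := ⟨a.1 - b.1, a.2 - b.2⟩

/-- A polygonal path `p` and a polygonal path `q` with disjoint edges, such that each endpoint of
either path can be strictly separated from the other path, have endpoints that do not interleave. -/
theorem not_interleaved_of_disjoint_paths {p q : ℕ → Pt} {S T : ℕ}
    (cell : ∀ s < S, ∀ t < T, ∃ u, ∀ s' ∈ Finset.Icc s (s + 1), ∀ t' ∈ Finset.Icc t (t + 1),
      displacement (p s') (q t') ∈ openHalfPlane u)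
    (hp₀ : ∃ u, ∀ t ≤ T, displacement (p 0) (q t) ∈ openHalfPlane u)
    (hp₁ : ∃ u, ∀ t ≤ T, displacement (p S) (q t) ∈ openHalfPlane u)
    (hq₀ : ∃ u, ∀ s ≤ S, displacement (p s) (q 0) ∈ openHalfPlane u)
    (hq₁ : ∃ u, ∀ s ≤ S, displacement (p s) (q T) ∈ openHalfPlane u) :
    ¬ (0 < orient (p 0) (q 0) (q T) ∧ 0 < orient (p 0) (p S) (q T) ∧
        orient (p S) (q 0) (q T) < 0 ∧ orient (p 0) (p S) (q 0) < 0) ∧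
    ¬ (orient (p 0) (q 0) (q T) < 0 ∧ orient (p 0) (p S) (q T) < 0 ∧
        0 < orient (p S) (q 0) (q T) ∧ 0 < orient (p 0) (p S) (q 0)) := by
  obtain ⟨_, hp₀⟩ := hp₀
  obtain ⟨_, hp₁⟩ := hp₁
  obtain ⟨_, hq₀⟩ := hq₀
  obtain ⟨_, hq₁⟩ := hq₁
  have total := grid_circulation (S := S) (T := T)
    (h := fun s t => signedAngle (displacement (p s) (q t)) (displacement (p s) (q (t + 1))))
    (v := fun s t => signedAngle (displacement (p s) (q t)) (displacement (p (s + 1)) (q t)))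
    fun s hs t ht => by
      obtain ⟨u, hu⟩ := cell s hs t ht
      have h₀₀ := hu s (by simp) t (by simp)
      have h₀₁ := hu s (by simp) (t + 1) (by simp)
      have h₁₀ := hu (s + 1) (by simp) t (by simp)
      have h₁₁ := hu (s + 1) (by simp) (t + 1) (by simp)
      rw [signedAngle_add h₀₀ h₀₁ h₁₁, signedAngle_add h₀₀ h₁₀ h₁₁]
  rw [sum_signedAngle hp₀, sum_signedAngle hp₁,
    sum_signedAngle (g := fun s => displacement (p s) (q 0)) hq₀,
    sum_signedAngle (g := fun s => displacement (p s) (q T)) hq₁] at total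
  constructor <;> rintro ⟨h₁, h₂, h₃, h₄⟩ <;> unfold orient at h₁ h₂ h₃ h₄
  · have a₁ : 0 < signedAngle (displacement (p 0) (q 0)) (displacement (p 0) (q T)) :=
      signedAngle_pos (by simp only [displacement]; linarith)
    have a₂ : 0 < signedAngle (displacement (p 0) (q T)) (displacement (p S) (q T)) :=
      signedAngle_pos (by simp only [displacement]; linarith)
    have a₃ : signedAngle (displacement (p S) (q 0)) (displacement (p S) (q T)) < 0 :=
      signedAngle_neg (by simp only [displacement]; linarith)
    have a₄ : signedAngle (displacement (p 0) (q 0)) (displacement (p S) (q 0)) < 0 :=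
      signedAngle_neg (by simp only [displacement]; linarith)
    linarith
  · have a₁ : signedAngle (displacement (p 0) (q 0)) (displacement (p 0) (q T)) < 0 :=
      signedAngle_neg (by simp only [displacement]; linarith)
    have a₂ : signedAngle (displacement (p 0) (q T)) (displacement (p S) (q T)) < 0 :=
      signedAngle_neg (by simp only [displacement]; linarith)
    have a₃ : 0 < signedAngle (displacement (p S) (q 0)) (displacement (p S) (q T)) :=
      signedAngle_pos (by simp only [displacement]; linarith)
    have a₄ : 0 < signedAngle (displacement (p 0) (q 0)) (displacement (p S) (q 0)) :=
      signedAngle_pos (by simp only [displacement]; linarith)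
    linarith

theorem continuousLinearMap_apply_pt (f : Pt →L[ℝ] ℝ) (x : Pt) :
    f x = x.1 * f (1, 0) + x.2 * f (0, 1) := by
  have : x = x.1 • ((1, 0) : Pt) + x.2 • ((0, 1) : Pt) := by ext <;> simp
  conv_lhs => rw [this]
  simp only [map_add, map_smul, smul_eq_mul]

/-- Disjoint compact convex sets have all their displacements in one open half-plane. -/
theorem exists_openHalfPlane_of_disjoint {A B : Set Pt} (hA : Convex ℝ A) (hA' : IsCompact A)
    (hB : Convex ℝ B) (hB' : IsCompact B) (h : Disjoint A B) :
    ∃ u, ∀ a ∈ A, ∀ b ∈ B, displacement a b ∈ openHalfPlane u := by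
  obtain ⟨f, r, s, hf, hrs, hs⟩ :=
    geometric_hahn_banach_compact_closed hB hB' hA hA'.isClosed h.symm
  refine ⟨⟨f (1, 0), f (0, 1)⟩, fun a ha b hb => ?_⟩
  have h₁ := hf b hb
  have h₂ := hs a ha
  rw [continuousLinearMap_apply_pt] at h₁ h₂
  simp only [openHalfPlane, displacement, Set.mem_ofPred_eq]
  linarith

theorem neg_mem_openHalfPlane {u z : ℂ} : -z ∈ openHalfPlane u ↔ z ∈ openHalfPlane (-u) := by
  simp [openHalfPlane]

theorem displacement_swap (a b : Pt) : displacement a b = -displacement b a := by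
  apply Complex.ext <;> simp [displacement]

theorem exists_openHalfPlane_of_mem_extremePoints {V : Set Pt} (hV : V.Finite) {a : Pt}
    (ha : a ∈ (convexHull ℝ V).extremePoints ℝ) :
    ∃ u, ∀ x ∈ V, x ≠ a → displacement a x ∈ openHalfPlane u := by
  have hnot := ((convex_convexHull ℝ V).mem_extremePoints_iff_mem_sdiff_convexHull_sdiff.1 ha).2
  obtain ⟨u, hu⟩ := exists_openHalfPlane_of_disjoint (convex_singleton a) isCompact_singleton
    (convex_convexHull ℝ (V \ {a})) ((hV.subset Set.sdiff_subset).isCompact_convexHull ℝ)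
    (Set.disjoint_singleton_left.2 fun h => hnot (convexHull_mono
      (Set.sdiff_subset_sdiff_left (subset_convexHull ℝ V)) h))
  exact ⟨u, fun x hx hxa => hu a rfl x (subset_convexHull ℝ _ ⟨hx, hxa⟩)⟩

theorem orient_rotate (a b c : Pt) : orient b c a = orient a b c := by
  unfold orient; ring

theorem orient_swap (a b c : Pt) : orient b a c = -orient a b c := by
  unfold orient; ring

/-- A point strictly separated from `a`, `b`, `c` by a line is not in their convex hull, expressed
with barycentric weights. -/
theorem not_orient_nonneg_of_openHalfPlane {u : ℂ} {a b c d : Pt}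
    (ha : displacement d a ∈ openHalfPlane u) (hb : displacement d b ∈ openHalfPlane u)
    (hc : displacement d c ∈ openHalfPlane u) (h₁ : 0 ≤ orient b c d) (h₂ : 0 ≤ orient c a d)
    (h₃ : 0 < orient a b d) : False := by
  simp only [openHalfPlane, displacement, Set.mem_ofPred_eq] at ha hb hc
  have e₁ := mul_nonneg h₁ ha.le
  have e₂ := mul_nonneg h₂ hb.le
  have e₃ := mul_pos h₃ hc
  unfold orient at e₁ e₂ e₃
  linarith

/-- Three points, each strictly separated from the other two by a line, are not collinear. -/
theorem orient_ne_zero_of_openHalfPlane {u v w : ℂ} {a b c : Pt}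
    (hab : displacement a b ∈ openHalfPlane u) (hac : displacement a c ∈ openHalfPlane u)
    (hba : displacement b a ∈ openHalfPlane v) (hbc : displacement b c ∈ openHalfPlane v)
    (hca : displacement c a ∈ openHalfPlane w) (hcb : displacement c b ∈ openHalfPlane w) :
    orient a b c ≠ 0 := by
  intro h
  simp only [openHalfPlane, displacement, Set.mem_ofPred_eq] at *
  unfold orient at h
  have hv := mul_pos hab hbc
  have hw := mul_pos hac hcb
  set α := (a.1 - b.1) * u.re + (a.2 - b.2) * u.im with hα
  set β := (a.1 - c.1) * u.re + (a.2 - c.2) * u.im with hβ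
  have ev : α * ((b.1 - c.1) * v.re + (b.2 - c.2) * v.im) =
      (α - β) * ((b.1 - a.1) * v.re + (b.2 - a.2) * v.im) := by
    rw [hα, hβ]
    linear_combination (u.re * v.im - u.im * v.re) * h
  have ew : β * ((c.1 - b.1) * w.re + (c.2 - b.2) * w.im) =
      (β - α) * ((c.1 - a.1) * w.re + (c.2 - a.2) * w.im) := by
    rw [hα, hβ]
    linear_combination (u.im * w.re - u.re * w.im) * h
  rw [ev] at hv
  rw [ew] at hw
  have := pos_of_mul_pos_left hv hba.le
  have := pos_of_mul_pos_left hw hca.le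
  linarith

/-- Each of `a`, `b`, `c`, `d` is strictly separated by a line from the other three. -/
structure StrictlyConvexPosition (a b c d : Pt) : Prop where
  sep₁ : ∃ u, displacement a b ∈ openHalfPlane u ∧ displacement a c ∈ openHalfPlane u ∧
    displacement a d ∈ openHalfPlane u
  sep₂ : ∃ u, displacement b a ∈ openHalfPlane u ∧ displacement b c ∈ openHalfPlane u ∧
    displacement b d ∈ openHalfPlane u
  sep₃ : ∃ u, displacement c a ∈ openHalfPlane u ∧ displacement c b ∈ openHalfPlane u ∧
    displacement c d ∈ openHalfPlane u
  sep₄ : ∃ u, displacement d a ∈ openHalfPlane u ∧ displacement d b ∈ openHalfPlane u ∧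
    displacement d c ∈ openHalfPlane u

/-- The pairs `{a, b}` and `{c, d}` do not interleave in the circular order of four points in
strictly convex position. -/
def NotInterleaved (a b c d : Pt) : Prop :=
  ¬ (0 < orient a c d ∧ 0 < orient a b d ∧ orient b c d < 0 ∧ orient a b c < 0) ∧
  ¬ (orient a c d < 0 ∧ orient a b d < 0 ∧ 0 < orient b c d ∧ 0 < orient a b c)

theorem StrictlyConvexPosition.orient_same_sign {a b c d : Pt}
    (h : StrictlyConvexPosition a b c d) (h₁ : NotInterleaved a b c d)
    (h₂ : NotInterleaved b c d a) :
    (0 < orient a b c ∧ 0 < orient a b d ∧ 0 < orient a c d ∧ 0 < orient b c d) ∨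
    (orient a b c < 0 ∧ orient a b d < 0 ∧ orient a c d < 0 ∧ orient b c d < 0) := by
  obtain ⟨⟨ua, hab, hac, had⟩, ⟨ub, hba, hbc, hbd⟩, ⟨uc, hca, hcb, hcd⟩, ⟨ud, hda, hdb, hdc⟩⟩ := h
  have n₁ := orient_ne_zero_of_openHalfPlane hab hac hba hbc hca hcb
  have n₂ := orient_ne_zero_of_openHalfPlane hab had hba hbd hda hdb
  have n₃ := orient_ne_zero_of_openHalfPlane hac had hca hcd hda hdc
  have n₄ := orient_ne_zero_of_openHalfPlane hbc hbd hcb hcd hdb hdc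
  have plucker : orient a b c + orient a c d = orient a b d + orient b c d := by
    unfold orient; ring
  have ta := not_orient_nonneg_of_openHalfPlane hab hac had
  have ta' := not_orient_nonneg_of_openHalfPlane hac hab had
  have tb := not_orient_nonneg_of_openHalfPlane hba hbc hbd
  have tb' := not_orient_nonneg_of_openHalfPlane hbc hba hbd
  have tc := not_orient_nonneg_of_openHalfPlane hca hcb hcd
  have tc' := not_orient_nonneg_of_openHalfPlane hcb hca hcd
  have td := not_orient_nonneg_of_openHalfPlane hda hdb hdc
  have td' := not_orient_nonneg_of_openHalfPlane hdb hda hdc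
  unfold NotInterleaved at h₁ h₂
  have r₁ : orient b d a = orient a b d := orient_rotate ..
  have r₂ : orient b c a = orient a b c := orient_rotate ..
  have r₃ : orient c d a = orient a c d := orient_rotate ..
  have e₁ : orient c a d = -orient a c d := orient_swap ..
  have e₂ : orient b a d = -orient a b d := orient_swap ..
  have e₃ : orient c b d = -orient b c d := orient_swap ..
  have e₄ : orient c d b = orient b c d := orient_rotate ..
  have e₅ : orient d b a = -orient a b d := by unfold orient; ring
  have e₆ : orient d c a = -orient a c d := by unfold orient; ring
  have e₇ : orient d c b = -orient b c d := by unfold orient; ring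
  have e₈ : orient d a b = orient a b d := by unfold orient; ring
  have e₉ : orient a c b = -orient a b c := by unfold orient; ring
  have e₁₀ : orient b a c = -orient a b c := by unfold orient; ring
  have e₁₁ : orient c a b = orient a b c := by unfold orient; ring
  have e₁₂ : orient c b a = -orient a b c := by unfold orient; ring
  have e₁₃ : orient d a c = orient a c d := by unfold orient; ring
  have e₁₄ : orient d b c = orient b c d := by unfold orient; ring
  have e₁₅ : orient a d b = -orient a b d := by unfold orient; ring
  have e₁₆ : orient a d c = -orient a c d := by unfold orient; ring
  have e₁₇ : orient b d c = -orient b c d := by unfold orient; ring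
  simp only [r₁, r₂, r₃, e₁, e₂, e₃, e₄, e₅, e₆, e₇, e₈, e₉, e₁₀, e₁₁, e₁₂, e₁₃, e₁₄, e₁₅, e₁₆,
    e₁₇, neg_pos, neg_nonneg] at *
  rcases n₁.lt_or_gt with s₁ | s₁ <;> rcases n₂.lt_or_gt with s₂ | s₂ <;>
    rcases n₃.lt_or_gt with s₃ | s₃ <;> rcases n₄.lt_or_gt with s₄ | s₄ <;>
    first
    | exact Or.inl ⟨s₁, s₂, s₃, s₄⟩
    | exact Or.inr ⟨s₁, s₂, s₃, s₄⟩
    | exact absurd plucker (by linarith)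
    | grind

theorem natCast_zmod_ne {n a b : ℕ} (hab : a < b) (hb : b < a + n) : (a : ZMod n) ≠ b := by
  intro h
  rw [ZMod.natCast_eq_natCast_iff, Nat.modEq_iff_dvd' hab.le] at h
  have := Nat.le_of_dvd (by omega) h
  omega

/-- If any four points of `E`, in increasing order, have triples of equal sign, then all increasing
triples of `E` have equal sign. -/
theorem uniform_sign_of_four {E : Set ℕ} {f : ℕ → ℕ → ℕ → ℝ}
    (four : ∀ a ∈ E, ∀ b ∈ E, ∀ c ∈ E, ∀ d ∈ E, a < b → b < c → c < d →
      (0 < f a b c ∧ 0 < f a b d ∧ 0 < f a c d ∧ 0 < f b c d) ∨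
      (f a b c < 0 ∧ f a b d < 0 ∧ f a c d < 0 ∧ f b c d < 0))
    (ne : ∀ a ∈ E, ∀ b ∈ E, ∀ c ∈ E, a < b → b < c → f a b c ≠ 0) :
    (∀ a ∈ E, ∀ b ∈ E, ∀ c ∈ E, a < b → b < c → 0 < f a b c) ∨
    (∀ a ∈ E, ∀ b ∈ E, ∀ c ∈ E, a < b → b < c → f a b c < 0) := by
  have pos_iff : ∀ a ∈ E, ∀ b ∈ E, ∀ c ∈ E, ∀ d ∈ E, a < b → b < c → c < d →
      (0 < f a b c ↔ 0 < f a b d) ∧ (0 < f a b d ↔ 0 < f a c d) ∧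
        (0 < f a c d ↔ 0 < f b c d) := by
    intro a ha b hb c hc d hd hab hbc hcd
    rcases four a ha b hb c hc d hd hab hbc hcd with ⟨h₁, h₂, h₃, h₄⟩ | ⟨h₁, h₂, h₃, h₄⟩
    · simp [h₁, h₂, h₃, h₄]
    · simp [h₁.not_gt, h₂.not_gt, h₃.not_gt, h₄.not_gt]
  have widen : ∀ x ∈ E, ∀ a ∈ E, ∀ b ∈ E, ∀ c ∈ E, ∀ y ∈ E, x ≤ a → a < b → b < c → c ≤ y →
      (0 < f a b c ↔ 0 < f x b y) := by
    intro x hx a ha b hb c hc y hy hxa hab hbc hcy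
    have left : 0 < f a b c ↔ 0 < f x b c := by
      rcases hxa.eq_or_lt with rfl | hxa
      · rfl
      · exact (pos_iff x hx a ha b hb c hc hxa hab hbc).2.2.symm
    rcases hcy.eq_or_lt with rfl | hcy
    · exact left
    · exact left.trans (pos_iff x hx b hb c hc y hy (by omega) hbc hcy).1
  have compare : ∀ a ∈ E, ∀ b ∈ E, ∀ c ∈ E, ∀ a' ∈ E, ∀ b' ∈ E, ∀ c' ∈ E, a < b → b < c →
      a' < b' → b' < c' → (0 < f a b c ↔ 0 < f a' b' c') := by
    intro a ha b hb c hc a' ha' b' hb' c' hc' hab hbc hab' hbc'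
    have hx : min a a' ∈ E := by rcases min_choice a a' with h | h <;> rwa [h]
    have hy : max c c' ∈ E := by rcases max_choice c c' with h | h <;> rwa [h]
    rw [widen _ hx a ha b hb c hc _ hy (min_le_left ..) hab hbc (le_max_left ..),
      widen _ hx a' ha' b' hb' c' hc' _ hy (min_le_right ..) hab' hbc' (le_max_right ..)]
    rcases lt_trichotomy b b' with h | rfl | h
    · exact (pos_iff _ hx b hb b' hb' _ hy (by omega) h (by omega)).2.1
    · rfl
    · exact (pos_iff _ hx b' hb' b hb _ hy (by omega) h (by omega)).2.1.symm
  by_contra! hcon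
  obtain ⟨⟨a, ha, b, hb, c, hc, hab, hbc, h⟩, ⟨a', ha', b', hb', c', hc', hab', hbc', h'⟩⟩ := hcon
  exact h.not_gt ((compare a ha b hb c hc a' ha' b' hb' c' hc' hab hbc hab' hbc').2
    (h'.lt_of_ne (ne a' ha' b' hb' c' hc' hab' hbc').symm))

namespace SimplePolygon

variable (P : SimplePolygon)

/-- The vertex with index `m` modulo the number of vertices. -/
def vert (m : ℕ) : Pt := P.verts (m : ZMod P.n)

/-- The natural numbers indexing extreme points of the convex hull. -/
def extremeIndices : Set ℕ :=
  {m | P.vert m ∈ (convexHull ℝ (Set.range P.verts)).extremePoints ℝ}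

variable {P}

theorem vert_ne {a b : ℕ} (hab : a < b) (hb : b < a + P.n) : P.vert a ≠ P.vert b :=
  P.inj.ne (natCast_zmod_ne hab hb)

theorem exists_openHalfPlane {m : ℕ} (hm : m ∈ P.extremeIndices) :
    ∃ u, ∀ l, P.vert l ≠ P.vert m → displacement (P.vert m) (P.vert l) ∈ openHalfPlane u := by
  have : NeZero P.n := ⟨by have := P.three_le; omega⟩
  obtain ⟨u, hu⟩ := exists_openHalfPlane_of_mem_extremePoints (Set.finite_range P.verts) hm
  exact ⟨u, fun l hl => hu _ (Set.mem_range_self _) hl⟩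

theorem disjoint_edges {m l : ℕ} (hml : m + 1 < l) (hl : l + 1 < m + P.n) :
    Disjoint (segment ℝ (P.vert m) (P.vert (m + 1))) (segment ℝ (P.vert l) (P.vert (l + 1))) := by
  have h := P.edges_nonadj m l (natCast_zmod_ne (by omega) (by omega)).symm
    (by exact_mod_cast (natCast_zmod_ne hml (by omega)).symm)
    (by exact_mod_cast natCast_zmod_ne (by omega : m < l + 1) hl)
  rw [Set.disjoint_iff_inter_eq_empty]
  simpa [vert] using h

theorem isCompact_segment_pt (a b : Pt) : IsCompact (segment ℝ a b) := by
  rw [← convexHull_pair]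
  exact (Set.toFinite _).isCompact_convexHull ℝ

theorem notInterleaved {a b c d : ℕ} (hab : a < b) (hbc : b < c) (hcd : c < d)
    (hd : d < a + P.n) (ha : a ∈ P.extremeIndices) (hb : b ∈ P.extremeIndices)
    (hc : c ∈ P.extremeIndices) (hd' : d ∈ P.extremeIndices) :
    NotInterleaved (P.vert a) (P.vert b) (P.vert c) (P.vert d) := by
  have key := not_interleaved_of_disjoint_paths (p := fun s => P.vert (a + s))
    (q := fun t => P.vert (c + t)) (S := b - a) (T := d - c) ?_ ?_ ?_ ?_ ?_
  · simpa [NotInterleaved, Nat.add_sub_cancel' hab.le, Nat.add_sub_cancel' hcd.le] using key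
  · intro s hs t ht
    obtain ⟨u, hu⟩ := exists_openHalfPlane_of_disjoint (convex_segment _ _)
      (isCompact_segment_pt _ _) (convex_segment _ _) (isCompact_segment_pt _ _)
      (P.disjoint_edges (m := a + s) (l := c + t) (by omega) (by omega))
    have mem : ∀ x k, ∀ k' ∈ Finset.Icc k (k + 1),
        P.vert (x + k') ∈ segment ℝ (P.vert (x + k)) (P.vert (x + k + 1)) := by
      intro x k k' hk'
      rw [Finset.mem_Icc] at hk'
      obtain rfl | rfl : k' = k ∨ k' = k + 1 := by omega
      · exact left_mem_segment ..
      · exact right_mem_segment ..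
    exact ⟨u, fun s' hs' t' ht' => hu _ (mem a s s' hs') _ (mem c t t' ht')⟩
  · obtain ⟨u, hu⟩ := exists_openHalfPlane ha
    exact ⟨u, fun t ht => hu _ (vert_ne (by omega) (by omega)).symm⟩
  · obtain ⟨u, hu⟩ := exists_openHalfPlane hb
    simp only [Nat.add_sub_cancel' hab.le]
    exact ⟨u, fun t ht => hu _ (vert_ne (by omega) (by omega)).symm⟩
  · obtain ⟨u, hu⟩ := exists_openHalfPlane hc
    refine ⟨-u, fun s hs => ?_⟩
    rw [← neg_mem_openHalfPlane, ← displacement_swap]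
    exact hu _ (vert_ne (by omega) (by omega))
  · obtain ⟨u, hu⟩ := exists_openHalfPlane hd'
    refine ⟨-u, fun s hs => ?_⟩
    simp only [Nat.add_sub_cancel' hcd.le]
    rw [← neg_mem_openHalfPlane, ← displacement_swap]
    exact hu _ (vert_ne (by omega) (by omega))

theorem vert_add_n (m : ℕ) : P.vert (m + P.n) = P.vert m := by simp [vert]

theorem strictlyConvexPosition {a b c d : ℕ} (hab : a < b) (hbc : b < c) (hcd : c < d)
    (hd : d < a + P.n) (ha : a ∈ P.extremeIndices) (hb : b ∈ P.extremeIndices)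
    (hc : c ∈ P.extremeIndices) (hd' : d ∈ P.extremeIndices) :
    StrictlyConvexPosition (P.vert a) (P.vert b) (P.vert c) (P.vert d) := by
  have nab := P.vert_ne hab (by omega)
  have nac := P.vert_ne (hab.trans hbc) (by omega)
  have nad := P.vert_ne (hab.trans (hbc.trans hcd)) hd
  have nbc := P.vert_ne hbc (by omega)
  have nbd := P.vert_ne (hbc.trans hcd) (by omega)
  have ncd := P.vert_ne hcd (by omega)
  obtain ⟨_, sa⟩ := exists_openHalfPlane ha
  obtain ⟨_, sb⟩ := exists_openHalfPlane hb
  obtain ⟨_, sc⟩ := exists_openHalfPlane hc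
  obtain ⟨_, sd⟩ := exists_openHalfPlane hd'
  exact ⟨⟨_, sa _ nab.symm, sa _ nac.symm, sa _ nad.symm⟩,
    ⟨_, sb _ nab, sb _ nbc.symm, sb _ nbd.symm⟩,
    ⟨_, sc _ nac, sc _ nbc, sc _ ncd.symm⟩, ⟨_, sd _ nad, sd _ nbd, sd _ ncd⟩⟩

theorem orient_vert_ne_zero {a b c : ℕ} (hab : a < b) (hbc : b < c) (hc : c < a + P.n)
    (ha : a ∈ P.extremeIndices) (hb : b ∈ P.extremeIndices) (hc' : c ∈ P.extremeIndices) :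
    orient (P.vert a) (P.vert b) (P.vert c) ≠ 0 := by
  have nab := P.vert_ne hab (by omega)
  have nac := P.vert_ne (hab.trans hbc) hc
  have nbc := P.vert_ne hbc (by omega)
  obtain ⟨_, sa⟩ := exists_openHalfPlane ha
  obtain ⟨_, sb⟩ := exists_openHalfPlane hb
  obtain ⟨_, sc⟩ := exists_openHalfPlane hc'
  exact orient_ne_zero_of_openHalfPlane (sa _ nab.symm) (sa _ nac.symm) (sb _ nab) (sb _ nbc.symm)
    (sc _ nac) (sc _ nbc)

variable (P) in
theorem orient_vert_uniform_sign :
    (∀ a ∈ P.extremeIndices ∩ Set.Iio P.n, ∀ b ∈ P.extremeIndices ∩ Set.Iio P.n,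
      ∀ c ∈ P.extremeIndices ∩ Set.Iio P.n, a < b → b < c →
        0 < orient (P.vert a) (P.vert b) (P.vert c)) ∨
    (∀ a ∈ P.extremeIndices ∩ Set.Iio P.n, ∀ b ∈ P.extremeIndices ∩ Set.Iio P.n,
      ∀ c ∈ P.extremeIndices ∩ Set.Iio P.n, a < b → b < c →
        orient (P.vert a) (P.vert b) (P.vert c) < 0) := by
  refine uniform_sign_of_four ?_ ?_
  · rintro a ⟨ha, -⟩ b ⟨hb, -⟩ c ⟨hc, -⟩ d ⟨hd, hdn⟩ hab hbc hcd
    rw [Set.mem_Iio] at hdn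
    have ha' : a + P.n ∈ P.extremeIndices := by
      rw [extremeIndices, Set.mem_ofPred_eq, vert_add_n]
      exact ha
    refine (strictlyConvexPosition hab hbc hcd (by omega) ha hb hc hd).orient_same_sign
      (notInterleaved hab hbc hcd (by omega) ha hb hc hd) ?_
    simpa only [vert_add_n] using
      notInterleaved hbc hcd (by omega : d < a + P.n) (by omega) hb hc hd ha'
  · rintro a ⟨ha, -⟩ b ⟨hb, -⟩ c ⟨hc, hcn⟩ hab hbc
    rw [Set.mem_Iio] at hcn
    exact orient_vert_ne_zero hab hbc (by omega) ha hb hc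

end SimplePolygon

theorem zmod_val_add_val_sub {n : ℕ} [NeZero n] (i j : ZMod n) :
    i.val + (j - i).val = j.val ∨ i.val + (j - i).val = j.val + n := by
  have h := ZMod.val_add i (j - i)
  rw [add_sub_cancel] at h
  have h₁ := i.val_lt
  have h₂ := (j - i).val_lt
  rcases lt_or_ge (i.val + (j - i).val) n with hlt | hge
  · rw [Nat.mod_eq_of_lt hlt] at h
    omega
  · rw [Nat.mod_eq_sub_mod hge, Nat.mod_eq_of_lt (by omega)] at h
    omega

/-- A property of triples invariant under rotation holds for all cyclically ordered triples of
`ZMod n` once it holds for those whose representatives are increasing. -/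
theorem cyclic_triple_induction {n : ℕ} [NeZero n] {Q : ZMod n → ZMod n → ZMod n → Prop}
    (rot : ∀ i j k, Q j k i → Q i j k)
    (sorted : ∀ i j k, i.val < j.val → j.val < k.val → Q i j k) {i j k : ZMod n} (hij : i ≠ j)
    (h : (j - i).val < (k - i).val) : Q i j k := by
  have hj := zmod_val_add_val_sub i j
  have hk := zmod_val_add_val_sub i k
  have hi := i.val_lt
  have hj' := j.val_lt
  have hk' := k.val_lt
  have hne : i.val ≠ j.val := fun e => hij (ZMod.val_injective n e)
  have hd := (k - i).val_lt
  have : (i.val < j.val ∧ j.val < k.val) ∨ (j.val < k.val ∧ k.val < i.val) ∨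
      (k.val < i.val ∧ i.val < j.val) := by omega
  rcases this with ⟨h₁, h₂⟩ | ⟨h₁, h₂⟩ | ⟨h₁, h₂⟩
  · exact sorted i j k h₁ h₂
  · exact rot i j k (sorted j k i h₁ h₂)
  · exact rot i j k (rot j k i (sorted k i j h₁ h₂))

/-- Order lemma, orientation form: in a simple polygon, for any three distinct extreme
points of the convex hull of its vertices, the cyclic orientation along the polygon
boundary agrees with the cyclic orientation along the convex hull boundary; i.e. there
is a single global orientation sign such that whenever indices `i, j, k` of extreme
points occur in this cyclic order along `P`, the triple of points has that orientation
sign. -/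
theorem hull_triple_orientation_agrees (P : SimplePolygon) :
    (∀ i j k : ZMod P.n,
      P.verts i ∈ Set.extremePoints ℝ (convexHull ℝ (Set.range P.verts)) →
      P.verts j ∈ Set.extremePoints ℝ (convexHull ℝ (Set.range P.verts)) →
      P.verts k ∈ Set.extremePoints ℝ (convexHull ℝ (Set.range P.verts)) →
      i ≠ j → j ≠ k → i ≠ k →
      (j - i).val < (k - i).val → 0 < orient (P.verts i) (P.verts j) (P.verts k)) ∨
    (∀ i j k : ZMod P.n,
      P.verts i ∈ Set.extremePoints ℝ (convexHull ℝ (Set.range P.verts)) →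
      P.verts j ∈ Set.extremePoints ℝ (convexHull ℝ (Set.range P.verts)) →
      P.verts k ∈ Set.extremePoints ℝ (convexHull ℝ (Set.range P.verts)) →
      i ≠ j → j ≠ k → i ≠ k →
      (j - i).val < (k - i).val → orient (P.verts i) (P.verts j) (P.verts k) < 0) := by
  have : NeZero P.n := ⟨by have := P.three_le; omega⟩
  have vert_val : ∀ i : ZMod P.n, P.vert i.val = P.verts i := fun i => by
    simp [SimplePolygon.vert]
  have mem : ∀ i : ZMod P.n,
      P.verts i ∈ Set.extremePoints ℝ (convexHull ℝ (Set.range P.verts)) →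
      i.val ∈ P.extremeIndices ∩ Set.Iio P.n := fun i hi =>
    ⟨by rw [SimplePolygon.extremeIndices, Set.mem_ofPred_eq, vert_val]; exact hi, i.val_lt⟩
  have extend : ∀ p : ℝ → Prop,
      (∀ a ∈ P.extremeIndices ∩ Set.Iio P.n, ∀ b ∈ P.extremeIndices ∩ Set.Iio P.n,
        ∀ c ∈ P.extremeIndices ∩ Set.Iio P.n, a < b → b < c →
          p (orient (P.vert a) (P.vert b) (P.vert c))) →
      ∀ i j k : ZMod P.n,
        P.verts i ∈ Set.extremePoints ℝ (convexHull ℝ (Set.range P.verts)) →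
        P.verts j ∈ Set.extremePoints ℝ (convexHull ℝ (Set.range P.verts)) →
        P.verts k ∈ Set.extremePoints ℝ (convexHull ℝ (Set.range P.verts)) →
        i ≠ j → j ≠ k → i ≠ k → (j - i).val < (k - i).val →
        p (orient (P.verts i) (P.verts j) (P.verts k)) := by
    intro p H i j k hi hj hk hij _ _ h
    refine cyclic_triple_induction (Q := fun i j k =>
      i.val ∈ P.extremeIndices ∩ Set.Iio P.n → j.val ∈ P.extremeIndices ∩ Set.Iio P.n →
      k.val ∈ P.extremeIndices ∩ Set.Iio P.n → p (orient (P.verts i) (P.verts j) (P.verts k)))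
      (fun i j k hQ hi hj hk => ?_) (fun i j k h₁ h₂ hi hj hk => ?_) hij h
      (mem i hi) (mem j hj) (mem k hk)
    · rw [← orient_rotate]
      exact hQ hj hk hi
    · simpa only [vert_val] using H _ hi _ hj _ hk h₁ h₂
  exact P.orient_vert_uniform_sign.imp (extend (0 < ·)) (extend (· < 0))
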